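/- arXiv:2603.07845 — 5 statements merged into one kernel-verified Lean document; each statement's English description precedes it below -/
import Mathlib

section
/- Let U be a finite set with |U| = m ≥ 1, let F' be a finite family of subsets of U with ⋃ F' = U, and let k be a natural number. Let D be a finite set disjoint from U, and form the augmented family F = F' ∪ { {e} : e ∈ D } of subsets of the universe U ∪ D. Then F' contains a subfamily of size at most k whose union equals U if and only if F contains a subfamily of size at most k whose union contains at least m elements of U ∪ D. -/
/-- A subfamily of a cover of `U` extends to a cover of `U` by adding at most one set per
uncovered element. -/
theorem exists_subcover_card_le {α : Type*} [DecidableEq α] {U : Finset α}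
    {C A : Finset (Finset α)} (hC : C.biUnion id = U) (hA : A ⊆ C) :
    ∃ T ⊆ C, T.card ≤ A.card + (U \ A.biUnion id).card ∧ T.biUnion id = U := by
  have hex : ∀ u ∈ U, ∃ V ∈ C, u ∈ V := fun u hu => by simpa [← hC] using hu
  choose! f hfC hf using hex
  have hsub : A ∪ (U \ A.biUnion id).image f ⊆ C :=
    Finset.union_subset hA <| Finset.image_subset_iff.2 fun u hu =>
      hfC u (Finset.mem_sdiff.1 hu).1
  refine ⟨_, hsub, (Finset.card_union_le _ _).trans ?_, ?_⟩
  · gcongr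
    exact Finset.card_image_le
  · refine Finset.Subset.antisymm
      ((Finset.biUnion_subset_biUnion_of_subset_left id hsub).trans hC.subset) ?_
    intro u hu
    by_cases hcov : u ∈ A.biUnion id
    · exact Finset.biUnion_subset_biUnion_of_subset_left id Finset.subset_union_left hcov
    · exact Finset.mem_biUnion.2 ⟨f u, Finset.mem_union_right _ <|
        Finset.mem_image_of_mem f (Finset.mem_sdiff.2 ⟨hu, hcov⟩), hf u hu⟩

/-- Let `U` be a finite set with `|U| = m ≥ 1`, `F'` a finite family of
subsets of `U` whose union is `U`, `k : ℕ`, and `D` a finite set disjoint from `U`.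
Form the augmented family `F = F' ∪ {{e} : e ∈ D}` over the universe `U ∪ D`.
Then `F'` has a subfamily of size at most `k` whose union equals `U` iff `F` has a
subfamily of size at most `k` whose union contains at least `m` elements of `U ∪ D`. -/
theorem stmt3 {α : Type} [DecidableEq α]
    (U : Finset α) (hm : 1 ≤ U.card)
    (F' : Finset (Finset α)) (hsub : ∀ S ∈ F', S ⊆ U)
    (hunion : F'.biUnion id = U)
    (D : Finset α) (hdisj : Disjoint U D)
    (k : ℕ) :
    (∃ S ⊆ F', S.card ≤ k ∧ S.biUnion id = U) ↔
    (∃ S ⊆ F' ∪ D.image (fun e => {e}), S.card ≤ k ∧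
      U.card ≤ ((S.biUnion id) ∩ (U ∪ D)).card) := by
  constructor
  · rintro ⟨S, hS, hk, hU⟩
    refine ⟨S, hS.trans Finset.subset_union_left, hk, ?_⟩
    rw [hU, Finset.inter_eq_left.2 Finset.subset_union_left]
  · rintro ⟨S, hS, hk, hcard⟩
    have hA : S ∩ F' ⊆ F' := Finset.inter_subset_right
    obtain ⟨T, hT, hTcard, hTU⟩ := exists_subcover_card_le hunion hA
    refine ⟨T, hT, ?_, hTU⟩
    have hsplit : S.biUnion id = (S ∩ F').biUnion id ∪ (S \ F').biUnion id := by
      rw [← Finset.union_biUnion, Finset.union_comm, Finset.sdiff_union_inter]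
    have hsingle : ((S \ F').biUnion id).card ≤ (S \ F').card * 1 := by
      refine Finset.card_biUnion_le_card_mul _ _ _ fun V hV => ?_
      obtain ⟨hVS, hVF⟩ := Finset.mem_sdiff.1 hV
      obtain ⟨e, -, rfl⟩ := Finset.mem_image.1 ((Finset.mem_union.1 (hS hVS)).resolve_left hVF)
      simp
    have hAU : (S ∩ F').biUnion id ⊆ U :=
      Finset.biUnion_subset.2 fun V hV => hsub V (hA hV)
    have hle : U.card ≤ ((S ∩ F').biUnion id).card + ((S \ F').biUnion id).card :=
      (hcard.trans (Finset.card_le_card Finset.inter_subset_left)).trans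
        (hsplit ▸ Finset.card_union_le _ _)
    have hdiff := Finset.card_sdiff_add_card_eq_card hAU
    have hScard := Finset.card_sdiff_add_card_inter S F'
    omega
end

section
/- Let G' = (V', E') be a finite simple graph with |E'| = m ≥ 1, let k ≥ 1 be an integer, and let G be the incidence bipartite graph of G'. Then G' has a vertex cover of size at most k if and only if there exists a sequence π of at most k distinct people of G such that the set of people in π is a backbone set of G and R(G, π) ≤ k·m. -/
/-- `tau adj S` : the maximum, over connected components of the bipartite project graph
(restricted to the remaining people `S`) that contain at least one person, of the number
of tasks in that component; `0` if there is no such component. A component containing a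
person `p ∈ S` with an adjacent task `t₀` consists exactly of the tasks linked to `t₀`
by alternating paths through people in `S`. -/
noncomputable def tau {P T : Type} (adj : P → T → Prop) (S : Set P) : ℕ :=
  sSup {n : ℕ | ∃ p ∈ S, ∃ t₀ : T, adj p t₀ ∧
    n = {τ : T | Relation.ReflTransGen
          (fun t₁ t₂ => ∃ q ∈ S, adj q t₁ ∧ adj q t₂) t₀ τ}.ncard}

/-- `RR adj π = R(G, π) = Σ_{i=1}^{|π|} τ(G_i^π)`, where `G_i^π` is the graph obtained by
deleting the first `i` people of the sequence `π`. -/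
noncomputable def RR {P T : Type} (adj : P → T → Prop) (π : List P) : ℕ :=
  ∑ i ∈ Finset.range π.length, tau adj {p : P | p ∉ π.take (i + 1)}

/-- `S` is a backbone set: after deleting the people in `S`, every task is adjacent to at
most one (remaining) person. -/
def Backbone {P T : Type} (adj : P → T → Prop) (S : Set P) : Prop :=
  ∀ τ : T, ∀ p ∉ S, ∀ q ∉ S, adj p τ → adj q τ → p = q

/-- A component never has more tasks than the whole project. -/
theorem tau_le_card {P T : Type} [Finite T] (adj : P → T → Prop) (S : Set P) :
    tau adj S ≤ Nat.card T := by
  refine csSup_le' ?_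
  rintro n ⟨p, -, t₀, -, rfl⟩
  exact Set.ncard_le_card _

theorem RR_le_length_mul_card {P T : Type} [Finite T] (adj : P → T → Prop) (π : List P) :
    RR adj π ≤ π.length * Nat.card T := by
  calc RR adj π ≤ ∑ _i ∈ Finset.range π.length, Nat.card T :=
        Finset.sum_le_sum fun _ _ => tau_le_card adj _
    _ = π.length * Nat.card T := by simp

/-- The backbone sets of an incidence bipartite graph are the vertex covers. -/
theorem backbone_incidence_iff {V : Type} (G' : SimpleGraph V) (C : Set V) :
    Backbone (fun (v : V) (e : ↥G'.edgeSet) => v ∈ e.val) C ↔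
      ∀ e ∈ G'.edgeSet, ∃ v ∈ C, v ∈ e := by
  constructor
  · intro h e he
    induction e using Sym2.ind with
    | _ a b =>
      by_contra! hc
      have ha : a ∉ C := fun ha => hc a ha (Sym2.mem_mk_left a b)
      have hb : b ∉ C := fun hb => hc b hb (Sym2.mem_mk_right a b)
      exact G'.ne_of_adj he
        (h ⟨s(a, b), he⟩ a ha b hb (Sym2.mem_mk_left a b) (Sym2.mem_mk_right a b))
  · rintro h ⟨e, he⟩ p hp q hq hpe hqe
    by_contra hpq
    obtain ⟨v, hv, hve⟩ := h e he
    obtain rfl : e = s(p, q) := (Sym2.mem_and_mem_iff hpq).1 ⟨hpe, hqe⟩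
    rw [Sym2.mem_iff] at hve
    rcases hve with rfl | rfl
    · exact hp hv
    · exact hq hv

/-- Let `G'` be a finite simple graph with `m = |E'| ≥ 1` edges, `k ≥ 1`, and
let `G` be its incidence bipartite graph (people = vertices, tasks = edges, a person is
joined to a task iff it is an endpoint of that edge). Then `G'` has a vertex cover of size
at most `k` iff there is a sequence `π` of at most `k` distinct people whose underlying
set is a backbone set of `G` and with `R(G, π) ≤ k·m`. -/
theorem stmt4 {V : Type} [Fintype V] (G' : SimpleGraph V)
    (hm : 1 ≤ G'.edgeSet.ncard) (k : ℕ) (hk : 1 ≤ k) :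
    (∃ C : Set V, C.ncard ≤ k ∧ ∀ e ∈ G'.edgeSet, ∃ v ∈ C, v ∈ e) ↔
    (∃ π : List V, π.Nodup ∧ π.length ≤ k ∧
      Backbone (fun (v : V) (e : ↥G'.edgeSet) => v ∈ e.val) {v : V | v ∈ π} ∧
      RR (fun (v : V) (e : ↥G'.edgeSet) => v ∈ e.val) π ≤ k * G'.edgeSet.ncard) := by
  classical
  constructor
  · rintro ⟨C, hC, hcover⟩
    have hlen : C.toFinset.toList.length ≤ k := by
      rwa [Finset.length_toList, ← Set.ncard_eq_toFinset_card']
    refine ⟨C.toFinset.toList, Finset.nodup_toList _, hlen, ?_, ?_⟩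
    · rw [backbone_incidence_iff]
      simpa using hcover
    · exact (RR_le_length_mul_card _ _).trans (Nat.mul_le_mul_right _ hlen)
  · rintro ⟨π, -, hlen, hback, -⟩
    refine ⟨{v | v ∈ π}, ?_, (backbone_incidence_iff G' _).1 hback⟩
    rw [← List.coe_toFinset, Set.ncard_coe_finset]
    exact (List.toFinset_card_le π).trans hlen
end

section
/- Let a ≥ 0, b ≥ 1, c ≥ 2 be integers and let G = (P, T, E) be the bipartite graph that is the disjoint union of a+1 dyads (a set D of a+1 people, each connected to its own private task, these a+1 tasks forming T₁) and a complete bipartite graph between a set Q of b people and a set T₂ of c tasks (P = D ∪ Q, T = T₁ ∪ T₂). Then: (i) φ(G[P∖D]) = a+1 > a, so D is a set of a+1 people whose removal isolates more than a tasks; and (ii) every set X ⊆ P such that every person in X has degree at least the degree of every person not in X, and such that φ(G[P∖X]) > a, satisfies |X| ≥ b. Consequently, removing people in non-increasing order of degree can produce a critical set of size b while a critical set of size a+1 exists. -/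
/-- `phi adj X` : the number of isolated tasks after deleting the people in `X`, i.e. the
number of tasks with no neighbor outside `X`. -/
noncomputable def phi {P T : Type} (adj : P → T → Prop) (X : Set P) : ℕ :=
  {τ : T | ∀ p, p ∉ X → ¬ adj p τ}.ncard

/-- `pdeg adj p` : the degree of a person, i.e. its number of adjacent tasks. -/
noncomputable def pdeg {P T : Type} (adj : P → T → Prop) (p : P) : ℕ :=
  {τ : T | adj p τ}.ncard

/-- The adjacency relation of the graph that is the disjoint union of `a+1` dyads
(people `Sum.inl i` each joined to their private task `Sum.inl i`) and a complete
bipartite graph between `b` people (`Sum.inr`) and `c` tasks (`Sum.inr`). -/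
def dyadCBAdj (a b c : ℕ) : (Fin (a + 1) ⊕ Fin b) → (Fin (a + 1) ⊕ Fin c) → Prop
  | .inl i, .inl j => i = j
  | .inr _, .inr _ => True
  | _, _ => False

theorem pdeg_dyadCBAdj_inl (a b c : ℕ) (i : Fin (a + 1)) :
    pdeg (dyadCBAdj a b c) (Sum.inl i) = 1 := by
  have h : {τ | dyadCBAdj a b c (Sum.inl i) τ} = {Sum.inl i} := by
    ext (j | j) <;> simp [dyadCBAdj, eq_comm]
  rw [pdeg, h, Set.ncard_singleton]

theorem pdeg_dyadCBAdj_inr (a b c : ℕ) (i : Fin b) :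
    pdeg (dyadCBAdj a b c) (Sum.inr i) = c := by
  have h : {τ | dyadCBAdj a b c (Sum.inr i) τ} = Set.range Sum.inr := by
    ext (j | j) <;> simp [dyadCBAdj]
  rw [pdeg, h, Set.ncard_range_of_injective Sum.inr_injective, Nat.card_eq_fintype_card,
    Fintype.card_fin]

/-- Deleting all dyad people isolates exactly the dyad tasks, as long as some other person
remains. -/
theorem phi_dyadCBAdj_range_inl (a b c : ℕ) (hb : 1 ≤ b) :
    phi (dyadCBAdj a b c) (Set.range Sum.inl) = a + 1 := by
  have h : {τ | ∀ p, p ∉ Set.range Sum.inl → ¬ dyadCBAdj a b c p τ} = Set.range Sum.inl := by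
    ext (j | j)
    · simp [dyadCBAdj]
    · simp [dyadCBAdj]
      exact ⟨0, hb⟩
  rw [phi, h, Set.ncard_range_of_injective Sum.inl_injective, Nat.card_eq_fintype_card,
    Fintype.card_fin]

/-- No task is isolated if every dyad person and at least one other person remain. -/
theorem phi_dyadCBAdj_eq_zero {a b c : ℕ} {X : Set (Fin (a + 1) ⊕ Fin b)}
    (hD : ∀ i, Sum.inl i ∉ X) {q : Fin b} (hq : Sum.inr q ∉ X) :
    phi (dyadCBAdj a b c) X = 0 := by
  have h : {τ | ∀ p, p ∉ X → ¬ dyadCBAdj a b c p τ} = ∅ := by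
    refine Set.eq_empty_of_forall_notMem ?_
    rintro (j | j) hτ
    · exact hτ _ (hD j) rfl
    · exact hτ _ hq trivial
  rw [phi, h, Set.ncard_empty]

/-- For the graph `G` that is the disjoint union of `a+1` dyads (set `D` of
people) and a complete bipartite graph between `b ≥ 1` people and `c ≥ 2` tasks:
(i) `|D| = a+1` and `φ(G[P∖D]) = a+1 > a`, so removing the `a+1` people of `D` isolates
more than `a` tasks; and (ii) every `X ⊆ P` such that every person in `X` has degree at
least the degree of every person not in `X`, and with `φ(G[P∖X]) > a`, has `|X| ≥ b`. -/
theorem stmt6 (a b c : ℕ) (hb : 1 ≤ b) (hc : 2 ≤ c) :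
    (Set.range (Sum.inl : Fin (a + 1) → Fin (a + 1) ⊕ Fin b)).ncard = a + 1 ∧
    phi (dyadCBAdj a b c) (Set.range Sum.inl) = a + 1 ∧
    (∀ X : Set (Fin (a + 1) ⊕ Fin b),
      (∀ p ∈ X, ∀ q, q ∉ X → pdeg (dyadCBAdj a b c) q ≤ pdeg (dyadCBAdj a b c) p) →
      a < phi (dyadCBAdj a b c) X → b ≤ X.ncard) := by
  refine ⟨?_, phi_dyadCBAdj_range_inl a b c hb, fun X hX hphi => ?_⟩
  · rw [Set.ncard_range_of_injective Sum.inl_injective, Nat.card_eq_fintype_card,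
      Fintype.card_fin]
  have hQ : Set.range Sum.inr ⊆ X := by
    rintro _ ⟨q, rfl⟩
    by_contra hq
    have hD : ∀ i, Sum.inl i ∉ X := fun i hi => by
      have hdeg := hX _ hi _ hq
      rw [pdeg_dyadCBAdj_inl, pdeg_dyadCBAdj_inr] at hdeg
      omega
    rw [phi_dyadCBAdj_eq_zero hD hq] at hphi
    exact Nat.not_lt_zero a hphi
  calc b = (Set.range (Sum.inr : Fin b → Fin (a + 1) ⊕ Fin b)).ncard := by
        rw [Set.ncard_range_of_injective Sum.inr_injective, Nat.card_eq_fintype_card,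
          Fintype.card_fin]
    _ ≤ X.ncard := Set.ncard_le_ncard hQ X.toFinite
end

section
/- Let k ≥ 2 be an integer and let S_k be the spider bipartite graph with people {p_0, p_1, …, p_k} and tasks {t_{i,j} : 1 ≤ i ≤ k, 0 ≤ j ≤ k}, where p_i is joined to t_{i,j} for all 0 ≤ j ≤ k, and p_0 is joined to t_{i,0} for each 1 ≤ i ≤ k (so S_k has n = k+1 people and m = k(k+1) tasks). Let π* = (p_0, p_1, …, p_k) be the ordering that removes the central person first. Then R(S_k, π*) = k(k+1), and moreover R(S_k, π) ≥ k(k+1) for every ordering π of all k+1 people; that is, π* achieves the minimum possible value of R over all full removal orders. -/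
/-- The spider bipartite graph `S_k`: people `p_0, …, p_k` (elements of `Fin (k+1)`),
tasks `t_{i,j}` for `1 ≤ i ≤ k`, `0 ≤ j ≤ k` (pairs `(i-1, j) : Fin k × Fin (k+1)`).
Person `p_i` (`i ≥ 1`) is joined to `t_{i,j}` for all `j`, and the central person `p_0`
is joined to `t_{i,0}` for each `i`. -/
def spiderAdj (k : ℕ) : Fin (k + 1) → Fin k × Fin (k + 1) → Prop :=
  fun p τ => (p = 0 ∧ τ.2 = 0) ∨ (p.val = τ.1.val + 1)

theorem ncard_le_tau {P T : Type} [Finite T] {adj : P → T → Prop} {S : Set P} {p : P} {t₀ : T}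
    {A : Set T} (hp : p ∈ S) (ht : adj p t₀)
    (hA : ∀ t ∈ A, Relation.ReflTransGen (fun t₁ t₂ => ∃ q ∈ S, adj q t₁ ∧ adj q t₂) t₀ t) :
    A.ncard ≤ tau adj S := by
  refine le_trans (Set.ncard_le_ncard hA (Set.toFinite _)) (le_csSup ⟨Nat.card T, ?_⟩ ?_)
  · rintro n ⟨q, -, t, -, rfl⟩
    exact Set.ncard_le_card _
  · exact ⟨p, hp, t₀, ht, rfl⟩

theorem tau_le {P T : Type} {adj : P → T → Prop} {S : Set P} {b : ℕ}
    (h : ∀ p ∈ S, ∀ t₀, adj p t₀ → {t : T | Relation.ReflTransGen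
      (fun t₁ t₂ => ∃ q ∈ S, adj q t₁ ∧ adj q t₂) t₀ t}.ncard ≤ b) :
    tau adj S ≤ b := by
  refine csSup_le' ?_
  rintro n ⟨p, hp, t₀, ht, rfl⟩
  exact h p hp t₀ ht

theorem ncard_leg (k : ℕ) (j : Fin k) : {t : Fin k × Fin (k + 1) | t.1 = j}.ncard = k + 1 := by
  have h : {t : Fin k × Fin (k + 1) | t.1 = j} = Set.range (Prod.mk j) := by
    ext ⟨a, b⟩
    simp [eq_comm]
  rw [h, ← Set.image_univ, Set.ncard_image_of_injective _ (Prod.mk_right_injective j)]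
  simp

theorem ncard_centre (k : ℕ) : {t : Fin k × Fin (k + 1) | t.2 = 0}.ncard = k := by
  have h : {t : Fin k × Fin (k + 1) | t.2 = 0} = Set.range (fun i => (i, 0)) := by
    ext ⟨a, b⟩
    simp [eq_comm]
  rw [h, ← Set.image_univ, Set.ncard_image_of_injective _ (Prod.mk_left_injective 0)]
  simp

theorem le_tau_of_leg_mem {k : ℕ} {S : Set (Fin (k + 1))} {j : Fin k} (hj : j.succ ∈ S) :
    k + 1 ≤ tau (spiderAdj k) S := by
  refine (ncard_leg k j).ge.trans ?_
  refine ncard_le_tau (t₀ := (j, 0)) hj (Or.inr (by simp)) fun t ht => .single ⟨_, hj, ?_, ?_⟩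
  · exact Or.inr (by simp)
  · exact Or.inr (by simp [ht.symm])

theorem le_tau_of_zero_mem {k : ℕ} (hk : 0 < k) {S : Set (Fin (k + 1))} (h0 : 0 ∈ S) :
    k ≤ tau (spiderAdj k) S := by
  refine (ncard_centre k).ge.trans ?_
  exact ncard_le_tau (t₀ := (⟨0, hk⟩, 0)) h0 (Or.inl ⟨rfl, rfl⟩)
    fun t ht => .single ⟨_, h0, Or.inl ⟨rfl, rfl⟩, Or.inl ⟨rfl, ht⟩⟩

theorem le_tau_of_zero_mem_of_leg_mem {k : ℕ} (hk : 2 ≤ k) {S : Set (Fin (k + 1))} {j : Fin k}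
    (h0 : 0 ∈ S) (hj : j.succ ∈ S) : k + 2 ≤ tau (spiderAdj k) S := by
  have : Nontrivial (Fin k) := Fin.nontrivial_iff_two_le.mpr hk
  obtain ⟨i, hi⟩ := exists_ne j
  have hc : (insert (i, 0) {t : Fin k × Fin (k + 1) | t.1 = j}).ncard = k + 2 := by
    rw [Set.ncard_insert_of_notMem (by simpa using hi) (Set.toFinite _), ncard_leg]
  rw [← hc]
  refine ncard_le_tau (t₀ := (j, 0)) hj (Or.inr (by simp)) ?_
  rintro t (rfl | ht)
  · exact .single ⟨_, h0, Or.inl ⟨rfl, rfl⟩, Or.inl ⟨rfl, rfl⟩⟩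
  · exact .single ⟨_, hj, Or.inr (by simp), Or.inr (by simp [Set.mem_ofPred.mp ht])⟩

theorem tau_le_of_zero_notMem {k : ℕ} {S : Set (Fin (k + 1))} (h0 : 0 ∉ S) :
    tau (spiderAdj k) S ≤ k + 1 := by
  refine tau_le fun p hp t₀ ht => ?_
  refine (Set.ncard_le_ncard (fun t h => ?_) (Set.toFinite _)).trans (ncard_leg k t₀.1).le
  induction h with
  | refl => rfl
  | tail _ hst ih =>
    obtain ⟨q, hq, hs, ht⟩ := hst
    have hq0 : q ≠ 0 := fun h => h0 (h ▸ hq)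
    simp only [spiderAdj, hq0, false_and, false_or] at hs ht
    refine Eq.trans ?_ ih
    ext
    omega

theorem List.Nodup.getElem_notMem_take {α : Type*} {l : List α} (hl : l.Nodup) {i j : ℕ}
    (hj : j < l.length) (hij : i ≤ j) : l[j] ∉ l.take i := by
  intro h
  obtain ⟨m, hm, he⟩ := List.mem_take_iff_getElem.mp h
  have := (hl.getElem_inj_iff).mp he
  omega

theorem le_RR_spider {k : ℕ} (hk : 2 ≤ k) {π : List (Fin (k + 1))} (hn : π.Nodup)
    (hπ : ∀ p, p ∈ π) : k * (k + 1) ≤ RR (spiderAdj k) π := by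
  have hlen : π.length = k + 1 := by
    have h := List.toFinset_card_of_nodup hn
    rw [Finset.eq_univ_iff_forall.mpr fun p => List.mem_toFinset.mpr (hπ p)] at h
    simpa using h.symm
  rw [RR, hlen, Finset.sum_range_succ]
  refine le_trans ?_ (Nat.le_add_right _ _)
  have hmem (i j : ℕ) (hj : j < k + 1) (hij : i < j) :
      π[j] ∈ {p : Fin (k + 1) | p ∉ π.take (i + 1)} :=
    hn.getElem_notMem_take (by omega) hij
  by_cases hlast : π[k] = 0
  · obtain ⟨m, rfl⟩ : ∃ m, k = m + 1 := ⟨k - 1, by omega⟩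
    have hne : π[m] ≠ 0 := fun h => by
      have := hn.getElem_inj_iff.mp (h.trans hlast.symm)
      omega
    obtain ⟨j, hj⟩ := Fin.exists_succ_eq.mpr hne
    rw [Finset.sum_range_succ]
    have h₁ := Finset.card_nsmul_le_sum (Finset.range m)
      (fun i => tau (spiderAdj (m + 1)) {p | p ∉ π.take (i + 1)}) (m + 1 + 2) fun i hi => by
        have hi := Finset.mem_range.mp hi
        refine le_tau_of_zero_mem_of_leg_mem hk (j := j) ?_ ?_
        · exact hlast ▸ hmem i (m + 1) (by omega) (by omega)
        · exact hj ▸ hmem i m (by omega) hi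
    have h₂ : m + 1 ≤ tau (spiderAdj (m + 1)) {p | p ∉ π.take (m + 1)} :=
      le_tau_of_zero_mem (by omega) (hlast ▸ hmem m (m + 1) (by omega) (by omega))
    simp only [Finset.card_range, smul_eq_mul] at h₁
    nlinarith
  · obtain ⟨j, hj⟩ := Fin.exists_succ_eq.mpr hlast
    have h := Finset.card_nsmul_le_sum (Finset.range k)
      (fun i => tau (spiderAdj k) {p | p ∉ π.take (i + 1)}) (k + 1) fun i hi =>
        le_tau_of_leg_mem (j := j) (hj ▸ hmem i k (by omega) (Finset.mem_range.mp hi))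
    simpa using h

theorem mem_zero_cons_ofFn_succ {k : ℕ} (p : Fin (k + 1)) :
    p ∈ (0 : Fin (k + 1)) :: List.ofFn (fun i : Fin k => i.succ) := by
  cases p using Fin.cases <;> simp [List.mem_ofFn]

theorem RR_spider_le (k : ℕ) :
    RR (spiderAdj k) ((0 : Fin (k + 1)) :: List.ofFn (fun i : Fin k => i.succ)) ≤
      k * (k + 1) := by
  have hlen : ((0 : Fin (k + 1)) :: List.ofFn (fun i : Fin k => i.succ)).length = k + 1 := by simp
  rw [RR, hlen, Finset.sum_range_succ, List.take_of_length_le hlen.le]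
  have h₀ : tau (spiderAdj k)
      {p | p ∉ (0 : Fin (k + 1)) :: List.ofFn (fun i : Fin k => i.succ)} ≤ 0 :=
    tau_le fun p hp => absurd (mem_zero_cons_ofFn_succ p) hp
  have h := Finset.sum_le_card_nsmul (Finset.range k)
    (fun i => tau (spiderAdj k)
      {p | p ∉ ((0 : Fin (k + 1)) :: List.ofFn (fun i : Fin k => i.succ)).take (i + 1)}) (k + 1)
    fun i _ => tau_le_of_zero_notMem (by simp)
  simp only [Finset.card_range, smul_eq_mul] at h
  omega

/-- For `k ≥ 2` and the spider graph `S_k`, the removal order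
`π* = (p_0, p_1, …, p_k)` (central person first) satisfies `R(S_k, π*) = k(k+1)`, and
every ordering `π` of all `k+1` people satisfies `R(S_k, π) ≥ k(k+1)`; so `π*` achieves
the minimum possible value of `R` over all full removal orders. -/
theorem stmt7 (k : ℕ) (hk : 2 ≤ k) :
    RR (spiderAdj k) ((0 : Fin (k + 1)) :: List.ofFn (fun i : Fin k => i.succ)) =
      k * (k + 1) ∧
    ∀ π : List (Fin (k + 1)), π.Nodup → (∀ p, p ∈ π) →
      k * (k + 1) ≤ RR (spiderAdj k) π := by
  refine ⟨le_antisymm (RR_spider_le k) (le_RR_spider hk ?_ mem_zero_cons_ofFn_succ),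
    fun π hn hπ => le_RR_spider hk hn hπ⟩
  simp [List.nodup_ofFn, Fin.succ_injective, List.mem_ofFn]
end

section
/- Let k ≥ 2 be an integer and let S_k be the spider bipartite graph with people {p_0, p_1, …, p_k} and tasks {t_{i,j} : 1 ≤ i ≤ k, 0 ≤ j ≤ k}, where p_i is joined to t_{i,j} for all 0 ≤ j ≤ k, and p_0 is joined to t_{i,0} for each 1 ≤ i ≤ k (so p_0 has degree k and each p_i with i ≥ 1 has degree k+1, n = k+1 people, m = k(k+1) tasks). Let π_deg = (p_1, …, p_k, p_0), an ordering of all people in non-increasing order of degree. Then R(S_k, π_deg) = (k³ + k²)/2, which equals (k/2)·k(k+1) = ((n−1)/2)·R(S_k, π*) where π* = (p_0, p_1, …, p_k) satisfies R(S_k, π*) = k(k+1); hence removal in non-increasing degree order incurs a ratio of (n−1)/2 on this family of graphs. -/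
theorem tau_eq_of_forall_ncard_eq {P T : Type} {adj : P → T → Prop} {S : Set P} {N : ℕ}
    (hne : ∃ p ∈ S, ∃ t, adj p t)
    (h : ∀ p ∈ S, ∀ t₀, adj p t₀ → {τ : T | Relation.ReflTransGen
      (fun t₁ t₂ => ∃ q ∈ S, adj q t₁ ∧ adj q t₂) t₀ τ}.ncard = N) :
    tau adj S = N := by
  unfold tau
  refine Eq.trans (congrArg sSup (Set.ext fun n => ?_)) (csSup_singleton N)
  constructor
  · rintro ⟨p, hp, t, ht, rfl⟩
    exact h p hp t ht
  · rintro rfl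
    obtain ⟨p, hp, t, ht⟩ := hne
    exact ⟨p, hp, t, ht, (h p hp t ht).symm⟩

theorem tau_empty {P T : Type} (adj : P → T → Prop) : tau adj ∅ = 0 := by
  simp [tau]

theorem mem_take_ofFn {α : Type} {n : ℕ} (f : Fin n → α) (m : ℕ) (a : α) :
    a ∈ (List.ofFn f).take m ↔ ∃ j : Fin n, j.val < m ∧ f j = a := by
  rw [List.mem_take_iff_getElem]
  constructor
  · rintro ⟨j, hj, rfl⟩
    simp only [List.length_ofFn, lt_min_iff] at hj
    exact ⟨⟨j, hj.2⟩, hj.1, by simp⟩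
  · rintro ⟨j, hj, rfl⟩
    exact ⟨j, by simp [hj], by simp⟩

/-- The number of tasks joined to the centre once `p_1, …, p_m` have been removed. -/
theorem ncard_center_component {k m : ℕ} (hm : m ≤ k) :
    {τ : Fin k × Fin (k + 1) | τ.2 = 0 ∨ m ≤ τ.1.val}.ncard = k * (k - m + 1) := by
  have hcompl : {τ : Fin k × Fin (k + 1) | τ.2 = 0 ∨ m ≤ τ.1.val}ᶜ =
      {i : Fin k | i.val < m} ×ˢ {(0 : Fin (k + 1))}ᶜ := by
    ext τ
    simp [and_comm]
  have hcard : {i : Fin k | i.val < m}.ncard = m := by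
    rw [Set.ncard_eq_toFinset_card']
    simp [Fin.card_filter_val_lt, hm]
  have h := Set.ncard_add_ncard_compl {τ : Fin k × Fin (k + 1) | τ.2 = 0 ∨ m ≤ τ.1.val}
  have h0 := Set.ncard_add_ncard_compl {(0 : Fin (k + 1))}
  rw [hcompl, Set.ncard_prod, hcard] at h
  simp only [Set.ncard_singleton, Nat.card_eq_fintype_card, Fintype.card_prod,
    Fintype.card_fin] at h h0
  obtain ⟨d, rfl⟩ := Nat.exists_eq_add_of_le hm
  have hz : ({(0 : Fin (m + d + 1))}ᶜ : Set _).ncard = m + d := by omega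
  rw [hz] at h
  rw [Nat.add_sub_cancel_left]
  nlinarith

theorem tau_spiderAdj_of_center {k m : ℕ} (hk : 0 < k) (hm : m ≤ k) :
    tau (spiderAdj k) {p | p = 0 ∨ m < p.val} = k * (k - m + 1) := by
  refine tau_eq_of_forall_ncard_eq ⟨0, .inl rfl, (⟨0, hk⟩, 0), .inl ⟨rfl, rfl⟩⟩ ?_
  intro p hp t₀ ht₀
  rw [← ncard_center_component hm]
  congr 1
  have mem_of_adj : ∀ q : Fin (k + 1), (q = 0 ∨ m < q.val) → ∀ τ, spiderAdj k q τ →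
      τ.2 = 0 ∨ m ≤ τ.1.val := by
    rintro q (rfl | hq) τ (⟨h, h'⟩ | h)
    · exact .inl h'
    · simp at h
    · exact .inl h'
    · right; omega
  have leg : ∀ τ : Fin k × Fin (k + 1), (τ.2 = 0 ∨ m ≤ τ.1.val) → τ = (τ.1, 0) ∨
      ∃ q : Fin (k + 1), (q = 0 ∨ m < q.val) ∧ spiderAdj k q τ ∧ spiderAdj k q (τ.1, 0) := by
    rintro ⟨i, j⟩ (h | h)
    · left; simpa using h
    · exact .inr ⟨i.succ, .inr (by simpa using Nat.lt_succ_of_le h),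
        .inr (by simp), .inr (by simp)⟩
  ext τ
  simp only [Set.mem_ofPred_eq]
  constructor
  · intro h
    induction h with
    | refl => exact mem_of_adj p hp _ ht₀
    | tail _ h _ =>
      obtain ⟨q, hq, _, h⟩ := h
      exact mem_of_adj q hq _ h
  · intro hτ
    have h₁ : Relation.ReflTransGen (fun t₁ t₂ => ∃ q : Fin (k + 1), (q = 0 ∨ m < q.val) ∧
        spiderAdj k q t₁ ∧ spiderAdj k q t₂) t₀ (t₀.1, 0) := by
      rcases leg t₀ (mem_of_adj p hp _ ht₀) with h | h
      · rw [← h]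
      · exact .single h
    have h₂ : Relation.ReflTransGen (fun t₁ t₂ => ∃ q : Fin (k + 1), (q = 0 ∨ m < q.val) ∧
        spiderAdj k q t₁ ∧ spiderAdj k q t₂) (τ.1, 0) τ := by
      rcases leg τ hτ with h | ⟨q, hq, h, h'⟩
      · rw [← h]
      · exact .single ⟨q, hq, h', h⟩
    exact (h₁.tail ⟨0, .inl rfl, .inl ⟨rfl, rfl⟩, .inl ⟨rfl, rfl⟩⟩).trans h₂

theorem tau_spiderAdj_of_legs {k m : ℕ} (hm : m < k) :
    tau (spiderAdj k) {p | m < p.val} = k + 1 := by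
  have adj_iff : ∀ q : Fin (k + 1), m < q.val → ∀ τ : Fin k × Fin (k + 1),
      spiderAdj k q τ ↔ q = τ.1.succ := by
    intro q hq τ
    have : q ≠ 0 := by rintro rfl; simp at hq
    simp only [spiderAdj, this, false_and, false_or, Fin.ext_iff, Fin.val_succ]
  refine tau_eq_of_forall_ncard_eq
    ⟨Fin.last k, hm, (⟨k - 1, by omega⟩, 0), .inr ?_⟩ ?_
  · simp; omega
  intro p hp t₀ ht₀
  have hcomp : {τ : Fin k × Fin (k + 1) | Relation.ReflTransGen
      (fun t₁ t₂ => ∃ q ∈ {p : Fin (k + 1) | m < p.val}, spiderAdj k q t₁ ∧ spiderAdj k q t₂)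
      t₀ τ} = {t₀.1} ×ˢ Set.univ := by
    ext τ
    simp only [Set.mem_ofPred_eq, Set.mem_prod, Set.mem_singleton_iff, Set.mem_univ, and_true]
    constructor
    · intro h
      induction h with
      | refl => rfl
      | tail _ h ih =>
        obtain ⟨q, hq, h₁, h₂⟩ := h
        rw [adj_iff q hq] at h₁ h₂
        rw [← ih]
        exact Fin.succ_injective _ (h₂.symm.trans h₁)
    · intro h
      refine .single ⟨p, hp, ht₀, ?_⟩
      rw [adj_iff p hp] at ht₀ ⊢
      rw [ht₀, h]
  rw [hcomp, Set.ncard_prod]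
  simp

theorem RR_spiderAdj_degree_order {k : ℕ} (hk : 0 < k) :
    2 * RR (spiderAdj k) (List.ofFn (fun i : Fin k => i.succ) ++ [(0 : Fin (k + 1))]) =
      k ^ 3 + k ^ 2 := by
  have hlast : {p : Fin (k + 1) | p ∉ (List.ofFn (fun i : Fin k => i.succ) ++
      [(0 : Fin (k + 1))]).take (k + 1)} = ∅ := by
    ext p
    rw [List.take_of_length_le (by simp)]
    refine Fin.cases ?_ (fun j => ?_) p <;> simp
  have hstep : ∀ i ∈ Finset.range k, tau (spiderAdj k) {p : Fin (k + 1) |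
      p ∉ (List.ofFn (fun i : Fin k => i.succ) ++ [(0 : Fin (k + 1))]).take (i + 1)} =
      k * (k - 1 - i + 1) := by
    intro i hi
    rw [Finset.mem_range] at hi
    have hset : {p : Fin (k + 1) | p ∉ (List.ofFn (fun i : Fin k => i.succ) ++
        [(0 : Fin (k + 1))]).take (i + 1)} = {p | p = 0 ∨ i + 1 < p.val} := by
      ext p
      rw [List.take_append_of_le_length (by simpa using hi)]
      simp only [Set.mem_ofPred_eq, mem_take_ofFn]
      refine Fin.cases ?_ (fun j => ?_) p <;> simp
    rw [hset, tau_spiderAdj_of_center hk (by omega), Nat.sub_sub, Nat.add_comm 1 i]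
  rw [RR, List.length_append, List.length_ofFn, List.length_singleton, Finset.sum_range_succ,
    hlast, tau_empty, Finset.sum_congr rfl hstep,
    Finset.sum_range_reflect (fun i => k * (i + 1)) k, ← Finset.mul_sum]
  have hgauss : ∀ n : ℕ, 2 * ∑ i ∈ Finset.range n, (i + 1) = n * (n + 1) := by
    intro n
    induction n with
    | zero => rfl
    | succ n ih => rw [Finset.sum_range_succ, mul_add, ih]; ring
  linear_combination k * hgauss k

theorem RR_spiderAdj_center_first (k : ℕ) :
    RR (spiderAdj k) ((0 : Fin (k + 1)) :: List.ofFn (fun i : Fin k => i.succ)) =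
      k * (k + 1) := by
  have hset : ∀ i : ℕ, {p : Fin (k + 1) | p ∉ ((0 : Fin (k + 1)) ::
      List.ofFn (fun i : Fin k => i.succ)).take (i + 1)} = {p | i < p.val} := by
    intro i
    ext p
    simp only [Set.mem_ofPred_eq, List.take_succ_cons, List.mem_cons, mem_take_ofFn]
    refine Fin.cases ?_ (fun j => ?_) p <;> simp
  have hlast : {p : Fin (k + 1) | k < p.val} = ∅ := by
    ext p
    simp [p.is_le]
  rw [RR, List.length_cons, List.length_ofFn]
  simp only [hset]
  rw [Finset.sum_range_succ, hlast, tau_empty, Finset.sum_congr rfl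
    (fun i hi => tau_spiderAdj_of_legs (Finset.mem_range.mp hi))]
  simp

/-- For `k ≥ 2` and the spider graph `S_k`, the non-increasing-degree
removal order `π_deg = (p_1, …, p_k, p_0)` satisfies `R(S_k, π_deg) = (k³ + k²)/2`,
which equals `(k/2)·k(k+1) = ((n−1)/2)·R(S_k, π*)`, where `π* = (p_0, p_1, …, p_k)`
satisfies `R(S_k, π*) = k(k+1)`; hence degree-order removal incurs a ratio of `(n−1)/2`
on this family of graphs. -/
theorem stmt8 (k : ℕ) (hk : 2 ≤ k) :
    RR (spiderAdj k) (List.ofFn (fun i : Fin k => i.succ) ++ [(0 : Fin (k + 1))]) =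
      (k ^ 3 + k ^ 2) / 2 ∧
    2 * RR (spiderAdj k) (List.ofFn (fun i : Fin k => i.succ) ++ [(0 : Fin (k + 1))]) =
      k ^ 3 + k ^ 2 ∧
    RR (spiderAdj k) ((0 : Fin (k + 1)) :: List.ofFn (fun i : Fin k => i.succ)) =
      k * (k + 1) ∧
    2 * RR (spiderAdj k) (List.ofFn (fun i : Fin k => i.succ) ++ [(0 : Fin (k + 1))]) =
      k * RR (spiderAdj k) ((0 : Fin (k + 1)) :: List.ofFn (fun i : Fin k => i.succ)) := by
  have hdeg := RR_spiderAdj_degree_order (k := k) (by omega)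
  have hcenter := RR_spiderAdj_center_first k
  refine ⟨by omega, hdeg, hcenter, ?_⟩
  rw [hdeg, hcenter]
  ring
end
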